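/- The DMA-protection finite state machine of VRASED satisfies LTL Specifications (7), (8) and (9). Precisely: let V(in) := (DMA_en ∧ (DMA_addr ∈ KR)) ∨ (DMA_en ∧ (DMA_addr ∈ XS)) ∨ ((PC ∈ CR) ∧ DMA_en), and let the FSM have states {Run, Reset} with δ(Run, in) = Reset iff V(in), δ(Run, in) = Run otherwise, δ(Reset, in) = Run iff PC = 0, δ(Reset, in) = Reset otherwise. For any input trace satisfying Axiom A4, the run of this FSM satisfies all three of: G: { DMA_en ∧ (DMA_addr ∈ KR) → reset }, G: { DMA_en ∧ (DMA_addr ∈ XS) → reset }, and G: { (PC ∈ CR) ∧ DMA_en → reset }. -/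

import Mathlib

/-- States of a two-state Run/Reset monitor FSM. -/
inductive S2 where
  | Run : S2
  | Reset : S2
deriving DecidableEq

-- Transition function of a two-state Run/Reset monitor: from `Run` it moves to
-- `Reset` exactly when the violation condition `V` holds of the current inputs, and
-- from `Reset` it moves back to `Run` exactly when `PC = 0`.
open Classical in
noncomputable def twoStateDelta (V : ℕ → Prop) (PC : ℕ → ℕ) : S2 → ℕ → S2
  | S2.Run, t => if V t then S2.Reset else S2.Run
  | S2.Reset, t => if PC t = 0 then S2.Run else S2.Reset

/-- If every violation occurs with a nonzero program counter, then a two-state monitor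
started in `Reset` is in `Reset` whenever a violation occurs. -/
theorem eq_reset_of_violation {V : ℕ → Prop} {PC : ℕ → ℕ} {s : ℕ → S2}
    (hs0 : s 0 = S2.Reset) (hstep : ∀ t, s (t + 1) = twoStateDelta V PC (s t) (t + 1))
    (hV : ∀ t, V t → PC t ≠ 0) {t : ℕ} (ht : V t) : s t = S2.Reset := by
  cases t with
  | zero => exact hs0
  | succ t =>
    rw [hstep]
    cases s t with
    | Run => exact if_pos ht
    | Reset => exact if_neg (hV _ ht)

/-- the DMA-protection FSM of VRASED, with violation condition
V := (DMA_en ∧ (DMA_addr ∈ KR)) ∨ (DMA_en ∧ (DMA_addr ∈ XS)) ∨ ((PC ∈ CR) ∧ DMA_en),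
satisfies, for any input trace satisfying Axiom A4, all three of:
LTL Specification (7): G { DMA_en ∧ (DMA_addr ∈ KR) → reset },
LTL Specification (8): G { DMA_en ∧ (DMA_addr ∈ XS) → reset },
LTL Specification (9): G { (PC ∈ CR) ∧ DMA_en → reset },
where reset(t) := (s(t) = Reset). -/
theorem dma_fsm_satisfies_spec7_spec8_spec9
    (CRmin CRmax Kmin Kmax XSmin XSmax : ℕ)
    (PC Daddr DMAaddr : ℕ → ℕ)
    (irq Ren Wen DMAen : ℕ → Prop)
    (s : ℕ → S2)
    (hs0 : s 0 = S2.Reset)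
    (hstep : ∀ t : ℕ, s (t + 1) =
      twoStateDelta
        (fun u =>
          (DMAen u ∧ (Kmin ≤ DMAaddr u ∧ DMAaddr u ≤ Kmax)) ∨
          (DMAen u ∧ (XSmin ≤ DMAaddr u ∧ DMAaddr u ≤ XSmax)) ∨
          ((CRmin ≤ PC u ∧ PC u ≤ CRmax) ∧ DMAen u))
        PC (s t) (t + 1))
    (hA4 : ∀ t : ℕ, PC t = 0 → ¬Ren t ∧ ¬Wen t ∧ ¬DMAen t ∧ ¬irq t) :
    (∀ t : ℕ, (DMAen t ∧ (Kmin ≤ DMAaddr t ∧ DMAaddr t ≤ Kmax)) → s t = S2.Reset) ∧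
    (∀ t : ℕ, (DMAen t ∧ (XSmin ≤ DMAaddr t ∧ DMAaddr t ≤ XSmax)) → s t = S2.Reset) ∧
    (∀ t : ℕ, ((CRmin ≤ PC t ∧ PC t ≤ CRmax) ∧ DMAen t) → s t = S2.Reset) := by
  have key := fun t => eq_reset_of_violation (t := t) hs0 hstep fun u hu h0 => by
    have hDMA := (hA4 u h0).2.2.1
    tauto
  exact ⟨fun t h => key t (.inl h), fun t h => key t (.inr (.inl h)),
    fun t h => key t (.inr (.inr h))⟩
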